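/- Let c be a general-model cost function (depending on tile and direction) on the infinite grid graph G with l layers, let T ⊆ V be nonempty and consistent with the grid, and let s ∈ V ∖ T. Then there exists a minimum-cost path P from s to T in (G, c) such that all edges of P preceding the first vertex of P that lies in a tile in which s does not lie are of the same type, i.e., all horizontal, all vertical, or all vias (if no vertex of P lies in a tile not containing s, then all edges of P are of the same type). -/

import Mathlib

/-- Vertices of the infinite grid graph: `(x, y, z)` where `z` is the layer. -/
abbrev Vtx : Type := ℤ × ℤ × ℤ

/-- Two vertices of the infinite grid graph with layers `1, …, l` are adjacent iff both have
their layer coordinate in `{1, …, l}` and they differ by exactly `1` in exactly one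
coordinate.  An edge changing the first coordinate is horizontal, one changing the second
coordinate is vertical, and one changing the third coordinate is a via. -/
def Adj (l : ℤ) (u v : Vtx) : Prop :=
  1 ≤ u.2.2 ∧ u.2.2 ≤ l ∧ 1 ≤ v.2.2 ∧ v.2.2 ≤ l ∧
    |u.1 - v.1| + |u.2.1 - v.2.1| + |u.2.2 - v.2.2| = 1

/-- Simple-model edge cost: a horizontal (resp. vertical) edge on layer `z` costs `ch z`
(resp. `cv z`) and a via between layers `z` and `z+1` costs `cvia z`. -/
def ecost (ch cv cvia : ℤ → ℝ) (u v : Vtx) : ℝ :=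
  if u.1 ≠ v.1 then ch u.2.2
  else if u.2.1 ≠ v.2.1 then cv u.2.2
  else cvia (min u.2.2 v.2.2)

/-- The cost of a walk (given as the list of its vertices) is the sum of its edge costs. -/
def wcost (c : Vtx → Vtx → ℝ) : List Vtx → ℝ
  | [] => 0
  | [_] => 0
  | u :: v :: P => c u v + wcost c (v :: P)

/-- `P` is a walk from `u` to `v` with respect to the adjacency relation `A`. -/
def IsWalkA (A : Vtx → Vtx → Prop) (P : List Vtx) (u v : Vtx) : Prop :=
  P ≠ [] ∧ P.Chain' A ∧ P.head? = some u ∧ P.getLast? = some v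

/-- The distance between two vertices: the infimum cost of a walk between them. -/
noncomputable def gdistA (A : Vtx → Vtx → Prop) (c : Vtx → Vtx → ℝ) (u v : Vtx) : ℝ :=
  sInf { m : ℝ | ∃ P, IsWalkA A P u v ∧ wcost c P = m }

/-- The distance from a vertex to a set of vertices. -/
noncomputable def gdistSetA (A : Vtx → Vtx → Prop) (c : Vtx → Vtx → ℝ) (u : Vtx)
    (T : Set Vtx) : ℝ :=
  sInf { m : ℝ | ∃ P v, v ∈ T ∧ IsWalkA A P u v ∧ wcost c P = m }

/-- `inSeg n ξ i x` states that the coordinate `x` lies in the `i`-th interval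
`[ξ^i, ξ^{i+1}]` of the rectilinear grid given by `ξ¹ ≤ … ≤ ξ^n`
(with the conventions `ξ⁰ = −∞` and `ξ^{n+1} = ∞`). -/
def inSeg (n : ℕ) (ξ : ℕ → ℤ) (i : ℕ) (x : ℤ) : Prop :=
  (i = 0 ∨ ξ i ≤ x) ∧ (i = n ∨ x ≤ ξ (i + 1))

/-- General-model edge cost: an edge lying in the tile with indices `(i, j, z)` costs
`ch i j z`, `cv i j z` or `cvia i j z` according to its direction (for a via between layers
`z` and `z+1` the lower layer `z` is used), and an edge lying in more than one tile gets the
minimum of the applicable costs. -/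
noncomputable def gecost (p q : ℕ) (ξ υ : ℕ → ℤ) (ch cv cvia : ℕ → ℕ → ℤ → ℝ)
    (u v : Vtx) : ℝ :=
  sInf { m : ℝ | ∃ i j : ℕ, i ≤ p ∧ j ≤ q ∧
    inSeg p ξ i u.1 ∧ inSeg p ξ i v.1 ∧ inSeg q υ j u.2.1 ∧ inSeg q υ j v.2.1 ∧
    m = if u.1 ≠ v.1 then ch i j u.2.2
        else if u.2.1 ≠ v.2.1 then cv i j u.2.2
        else cvia i j (min u.2.2 v.2.2) }

/-- The rectangle with corner grid indices `i₁, i₂` (in x), `j₁, j₂` (in y), on layer `ζ`. -/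
def GridRect (ξ υ : ℕ → ℤ) (i₁ i₂ j₁ j₂ : ℕ) (ζ : ℤ) : Set Vtx :=
  { w | ξ i₁ ≤ w.1 ∧ w.1 ≤ ξ i₂ ∧ υ j₁ ≤ w.2.1 ∧ w.2.1 ≤ υ j₂ ∧ w.2.2 = ζ }

/-- `T` is consistent with the grid: it is a finite union of rectangles whose corner
coordinates are grid coordinates `ξ^{i⁻} ≤ x ≤ ξ^{i⁺}`, `υ^{j⁻} ≤ y ≤ υ^{j⁺}` with
`1 ≤ i⁻ ≤ i⁺ ≤ p`, `1 ≤ j⁻ ≤ j⁺ ≤ q`, each on a single layer `ζ ∈ {1, …, l}`. -/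
def Consistent (p q : ℕ) (ξ υ : ℕ → ℤ) (l : ℤ) (T : Set Vtx) : Prop :=
  ∃ R : Finset ((ℕ × ℕ) × (ℕ × ℕ) × ℤ),
    (∀ r ∈ R, 1 ≤ r.1.1 ∧ r.1.1 ≤ r.1.2 ∧ r.1.2 ≤ p ∧
       1 ≤ r.2.1.1 ∧ r.2.1.1 ≤ r.2.1.2 ∧ r.2.1.2 ≤ q ∧ 1 ≤ r.2.2 ∧ r.2.2 ≤ l) ∧
    T = ⋃ r ∈ R, GridRect ξ υ r.1.1 r.1.2 r.2.1.1 r.2.1.2 r.2.2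

/-- The direction of an edge: horizontal, vertical, or via. -/
inductive Dir : Type
  | hor | ver | via
deriving DecidableEq

/-- The direction of the edge from `u` to `v`. -/
def dirOf (u v : Vtx) : Dir :=
  if u.1 ≠ v.1 then .hor else if u.2.1 ≠ v.2.1 then .ver else .via

/-- The list of directions of the edges of a walk. -/
def dirs (P : List Vtx) : List Dir := List.zipWith dirOf P P.tail

/-- `v` lies only in tiles in which `s` also lies: every tile of the grid containing `v`
contains `s` as well. -/
def OnlyTilesOf (p q : ℕ) (ξ υ : ℕ → ℤ) (s v : Vtx) : Prop :=
  ∀ i j : ℕ, i ≤ p → j ≤ q → inSeg p ξ i v.1 → inSeg q υ j v.2.1 →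
    (inSeg p ξ i s.1 ∧ inSeg q υ j s.2.1 ∧ s.2.2 = v.2.2)

/-- Walks as an inductive relation, recording the cost. -/
inductive CW (A : Vtx → Vtx → Prop) (c : Vtx → Vtx → ℝ) : Vtx → Vtx → ℝ → Prop
  | nil (u : Vtx) : CW A c u u 0
  | cons {u v w : Vtx} {C : ℝ} : A u v → CW A c v w C → CW A c u w (c u v + C)

namespace CW

variable {A A' : Vtx → Vtx → Prop} {c : Vtx → Vtx → ℝ}

lemma single {u v : Vtx} (h : A u v) : CW A c u v (c u v) := by
  simpa using CW.cons (c := c) h (CW.nil v)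

lemma append {u v w : Vtx} {C D : ℝ} (h : CW A c u v C) (h' : CW A c v w D) :
    CW A c u w (C + D) := by
  induction h with
  | nil u => simpa using h'
  | cons a _ ih => rw [add_assoc]; exact CW.cons a (ih h')

lemma reverse (hA : ∀ u v, A u v → A v u) (hc : ∀ u v, A u v → c u v = c v u)
    {u v : Vtx} {C : ℝ} (h : CW A c u v C) : CW A c v u C := by
  induction h with
  | nil u => exact CW.nil u
  | cons a _ ih =>
    rw [add_comm, hc _ _ a]
    exact ih.append (single (hA _ _ a))

lemma line (f : ℤ → Vtx) (m : ℝ) (a b : ℤ) (hab : a ≤ b)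
    (h : ∀ k, a ≤ k → k < b → A (f k) (f (k + 1)) ∧ c (f k) (f (k + 1)) = m) :
    CW A c (f a) (f b) (((b - a : ℤ) : ℝ) * m) := by
  induction b, hab using Int.leInduction with
  | base => simpa using CW.nil (A := A) (c := c) (f a)
  | succ n hn ih =>
    have h1 := ih (fun k hk hk' => h k hk (by omega))
    obtain ⟨h2, h3⟩ := h n hn (by omega)
    have h4 := h1.append (single (c := c) h2)
    rw [h3] at h4
    convert h4 using 1
    push_cast
    ring

lemma map_rel (σ : Vtx → Vtx) {c' : Vtx → Vtx → ℝ} (h : ∀ u v, A u v → A' (σ u) (σ v))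
    (hc : ∀ u v, A u v → c u v = c' (σ u) (σ v)) {u v : Vtx} {C : ℝ} (hw : CW A c u v C) :
    CW A' c' (σ u) (σ v) C := by
  induction hw with
  | nil u => exact CW.nil _
  | cons a _ ih => rw [hc _ _ a]; exact CW.cons (h _ _ a) ih

lemma recost {u v : Vtx} {C : ℝ} (c' : Vtx → Vtx → ℝ) (h : CW A c u v C) :
    ∃ D, CW A c' u v D := by
  induction h with
  | nil u => exact ⟨0, CW.nil u⟩
  | cons a _ ih => obtain ⟨D, hD⟩ := ih; exact ⟨_, CW.cons a hD⟩

/-- Averaging: a family of maps which on average does not increase edge costs. -/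
lemma round {ι : Type} (S : Finset ι) (hS : S.Nonempty) (φ : ι → Vtx → Vtx)
    (hedge : ∀ u v, A u v → ∃ g : ι → ℝ, (∀ i ∈ S, CW A' c (φ i u) (φ i v) (g i)) ∧
      ∑ i ∈ S, g i ≤ (S.card : ℝ) * c u v) {u v : Vtx} {C : ℝ} (h : CW A c u v C) :
    ∃ i ∈ S, ∃ C' ≤ C, CW A' c (φ i u) (φ i v) C' := by
  have key : ∃ g : ι → ℝ, (∀ i ∈ S, CW A' c (φ i u) (φ i v) (g i)) ∧
      ∑ i ∈ S, g i ≤ (S.card : ℝ) * C := by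
    induction h with
    | nil u => exact ⟨fun _ => 0, fun i _ => CW.nil _, by simp⟩
    | cons a _ ih =>
      obtain ⟨g, hg, hg'⟩ := ih
      obtain ⟨f, hf, hf'⟩ := hedge _ _ a
      refine ⟨fun i => f i + g i, fun i hi => (hf i hi).append (hg i hi), ?_⟩
      rw [Finset.sum_add_distrib, mul_add]
      exact add_le_add hf' hg'
  obtain ⟨g, hg, hg'⟩ := key
  obtain ⟨i, hi, hi'⟩ := Finset.exists_le_of_sum_le (s := S) (f := g) (g := fun _ => C) hS
    (by simpa using hg')
  exact ⟨i, hi, g i, hi', hg i hi⟩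

lemma toList {u v : Vtx} {C : ℝ} (h : CW A c u v C) :
    ∃ P, IsWalkA A P u v ∧ wcost c P = C := by
  induction h with
  | nil u => exact ⟨[u], ⟨by simp, List.isChain_singleton u, rfl, rfl⟩, rfl⟩
  | @cons u v w C a _ ih =>
    obtain ⟨P, ⟨h1, h2, h3, h4⟩, h5⟩ := ih
    cases P with
    | nil => exact absurd rfl h1
    | cons x P =>
      simp only [List.head?_cons, Option.some.injEq] at h3
      subst h3
      refine ⟨u :: x :: P, ⟨by simp, ?_, by simp, ?_⟩, ?_⟩
      · exact List.IsChain.cons_cons a h2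
      · simpa using h4
      · simp [wcost, h5]

lemma ofList {u v : Vtx} (P : List Vtx) (h : IsWalkA A P u v) : CW A c u v (wcost c P) := by
  induction P generalizing u with
  | nil => exact absurd rfl h.1
  | cons x P ih =>
    obtain ⟨h1, h2, h3, h4⟩ := h
    simp only [List.head?_cons, Option.some.injEq] at h3
    subst h3
    cases P with
    | nil =>
      simp at h4
      subst h4
      exact CW.nil _
    | cons y P =>
      have h2' := List.isChain_cons_cons.1 h2
      exact CW.cons h2'.1 (ih ⟨by simp, h2'.2, by simp, by simpa using h4⟩)

end CW

/-- Every grid line constraint satisfied (weakly) by `y` is satisfied by `w`. -/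
def Dom (q : ℕ) (υ : ℕ → ℤ) (y w : ℤ) : Prop :=
  ∀ j, 1 ≤ j → j ≤ q → (υ j ≤ y → υ j ≤ w) ∧ (y ≤ υ j → w ≤ υ j)

/-- The grid with non-vertical edges at levels in `Y` and non-horizontal edges at
abscissas in `X` removed. -/
def Ag (l : ℤ) (Y X : Set ℤ) (u v : Vtx) : Prop :=
  Adj l u v ∧ (u.2.1 = v.2.1 → u.2.1 ∉ Y) ∧ (u.1 = v.1 → u.1 ∉ X)

lemma Adj.symm' {l : ℤ} {u v : Vtx} (h : Adj l u v) : Adj l v u := by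
  obtain ⟨h1, h2, h3, h4, h5⟩ := h
  refine ⟨h3, h4, h1, h2, ?_⟩
  rw [abs_sub_comm v.1, abs_sub_comm v.2.1, abs_sub_comm v.2.2]
  exact h5

lemma Ag.symm' {l : ℤ} {Y X : Set ℤ} {u v : Vtx} (h : Ag l Y X u v) : Ag l Y X v u := by
  obtain ⟨h1, h2, h3⟩ := h
  exact ⟨h1.symm', fun e => e ▸ h2 e.symm, fun e => e ▸ h3 e.symm⟩

/-- The properties of the cost function used in the rounding argument. -/
structure YHyp (l : ℤ) (c : Vtx → Vtx → ℝ) (q : ℕ) (υ : ℕ → ℤ) : Prop where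
  nonneg : ∀ u v, Adj l u v → 0 ≤ c u v
  symm : ∀ u v, Adj l u v → c u v = c v u
  mono : ∀ y y', Dom q υ y y' → ∀ x x' z z', Adj l (x, y, z) (x', y, z') →
    c (x, y', z) (x', y', z') ≤ c (x, y, z) (x', y, z')
  flat : ∀ a b : ℤ, (∀ j, 1 ≤ j → j ≤ q → ¬ (a < υ j ∧ υ j < b)) →
    ∀ y w, a ≤ y → y < b → a ≤ w → w < b → ∀ x z, 1 ≤ z → z ≤ l →
    c (x, y, z) (x, y + 1, z) = c (x, w, z) (x, w + 1, z)

/-- Apply a map to the second coordinate. -/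
def mapY (φ : ℤ → ℤ) (u : Vtx) : Vtx := (u.1, φ u.2.1, u.2.2)

/-- General rounding step: it is enough to treat upward vertical edges. -/
lemma round_step {l : ℤ} {c : Vtx → Vtx → ℝ} {q : ℕ} {υ : ℕ → ℤ} (H : YHyp l c q υ)
    {ι : Type} (S : Finset ι) (hS : S.Nonempty) (φ : ι → ℤ → ℤ) (Y Y' X : Set ℤ)
    (hD : ∀ i ∈ S, ∀ y, Dom q υ y (φ i y)) (hY : ∀ i ∈ S, ∀ y, y ∉ Y → φ i y ∉ Y')
    (hver : ∀ x y z, 1 ≤ z → z ≤ l → x ∉ X → ∃ g : ι → ℝ,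
      (∀ i ∈ S, CW (Ag l Y' X) c (x, φ i y, z) (x, φ i (y + 1), z) (g i)) ∧
      ∑ i ∈ S, g i ≤ (S.card : ℝ) * c (x, y, z) (x, y + 1, z))
    {u v : Vtx} {C : ℝ} (h : CW (Ag l Y X) c u v C) :
    ∃ i ∈ S, ∃ C' ≤ C, CW (Ag l Y' X) c (mapY (φ i) u) (mapY (φ i) v) C' := by
  refine CW.round S hS (fun i => mapY (φ i)) ?_ h
  rintro ⟨x, y, z⟩ ⟨x', y', z'⟩ ⟨h1, h2, h3⟩
  by_cases hyy : y = y'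
  · subst hyy
    refine ⟨fun i => c (x, φ i y, z) (x', φ i y, z'), fun i hi => ?_, ?_⟩
    · apply CW.single
      refine ⟨?_, fun _ => hY i hi y (h2 rfl), h3⟩
      simpa [Adj, mapY] using h1
    · have := Finset.sum_le_card_nsmul S (fun i => c (x, φ i y, z) (x', φ i y, z'))
        (c (x, y, z) (x', y, z')) (fun i hi => H.mono _ _ (hD i hi y) _ _ _ _ h1)
      simpa using this
  · have h1' := h1
    obtain ⟨a1, a2, a3, a4, a5⟩ := h1'
    simp only at a1 a2 a3 a4 a5 h2 h3
    have hx : x = x' := by grind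
    have hz : z = z' := by grind
    subst hx hz
    have hx' : x ∉ X := h3 rfl
    have : y' = y + 1 ∨ y = y' + 1 := by
      simp only [sub_self, abs_zero, zero_add, add_zero] at a5
      rcases abs_cases (y - y') with ⟨e, _⟩ | ⟨e, _⟩ <;> omega
    rcases this with rfl | rfl
    · exact hver x y z a1 a2 hx'
    · obtain ⟨g, hg, hg'⟩ := hver x y' z a1 a2 hx'
      refine ⟨g, fun i hi => ?_, ?_⟩
      · exact (hg i hi).reverse (fun _ _ => Ag.symm') (fun u v h => H.symm u v h.1)
      · rw [H.symm _ _ h1]; exact hg'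

lemma adj_ver {l : ℤ} {x y z : ℤ} (h1 : 1 ≤ z) (h2 : z ≤ l) :
    Adj l (x, y, z) (x, y + 1, z) := ⟨h1, h2, h1, h2, by grind⟩

lemma ag_ver {l : ℤ} {Y X : Set ℤ} {x y z : ℤ} (h1 : 1 ≤ z) (h2 : z ≤ l) (hx : x ∉ X) :
    Ag l Y X (x, y, z) (x, y + 1, z) := ⟨adj_ver h1 h2, by simp, fun _ => hx⟩

lemma slab_step {l : ℤ} {c : Vtx → Vtx → ℝ} {q : ℕ} {υ : ℕ → ℤ} (H : YHyp l c q υ)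
    (Y X : Set ℤ) (a b : ℤ) (hab : a < b) (haY : a ∉ Y) (hbY : b ∉ Y)
    (hno : ∀ j, 1 ≤ j → j ≤ q → ¬ (a < υ j ∧ υ j < b))
    {u v : Vtx} {C : ℝ} (h : CW (Ag l Y X) c u v C) :
    ∃ φ : ℤ → ℤ, (∀ y ∉ Set.Ioo a b, φ y = y) ∧ (∀ y, Dom q υ y (φ y)) ∧
    ∃ C' ≤ C, CW (Ag l (Y ∪ Set.Ioo a b) X) c (mapY φ u) (mapY φ v) C' := by
  let φ : ℤ → ℤ → ℤ := fun θ y => if a < y ∧ y < b then (if y < θ then a else b) else y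
  have hD : ∀ θ y, Dom q υ y (φ θ y) := by
    intro θ y j h1 h2
    have := hno j h1 h2
    simp only [φ]
    split_ifs <;> constructor <;> intro <;> omega
  have key := round_step H (Finset.Ioc a b) ⟨b, by simp [hab]⟩ φ Y (Y ∪ Set.Ioo a b) X
    (fun θ _ y => hD θ y) ?_ ?_ h
  · obtain ⟨θ, -, C', hC', hw⟩ := key
    refine ⟨φ θ, ?_, hD θ, C', hC', hw⟩
    intro y hy
    simp only [φ]
    rw [if_neg (by simpa using hy)]
  · intro θ _ y hy
    simp only [φ]
    split_ifs with h1 h2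
    · simp [haY]
    · simp [hbY]
    · simp only [Set.mem_union, Set.mem_Ioo, not_or]
      exact ⟨hy, h1⟩
  · intro x y z hz1 hz2 hx
    by_cases hy : a ≤ y ∧ y < b
    · set m := c (x, y, z) (x, y + 1, z) with hm
      refine ⟨fun θ => if θ = y + 1 then ((b - a : ℤ) : ℝ) * m else 0, ?_, ?_⟩
      · intro θ hθ
        rw [Finset.mem_Ioc] at hθ
        dsimp only
        split_ifs with he
        · have e1 : φ θ y = a := by
            simp only [φ]; split_ifs <;> omega
          have e2 : φ θ (y + 1) = b := by
            simp only [φ]; split_ifs <;> omega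
          rw [e1, e2]
          refine CW.line (fun k => (x, k, z)) m a b hab.le ?_
          intro k hk hk'
          exact ⟨ag_ver hz1 hz2 hx, H.flat a b hno k y hk hk' hy.1 hy.2 x z hz1 hz2⟩
        · have e1 : φ θ y = φ θ (y + 1) := by
            simp only [φ]; split_ifs <;> omega
          rw [e1]
          exact CW.nil _
      · rw [Finset.sum_ite_eq' , if_pos (by simp; omega)]
        apply le_of_eq
        congr 1
        rw [Int.card_Ioc, ← Int.cast_natCast (R := ℝ), Int.toNat_of_nonneg (by omega)]
    · refine ⟨fun θ => c (x, y, z) (x, y + 1, z), ?_, by simp⟩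
      intro θ hθ
      have e1 : φ θ y = y := by
        simp only [φ]; split_ifs <;> omega
      have e2 : φ θ (y + 1) = y + 1 := by
        simp only [φ]; split_ifs <;> omega
      rw [e1, e2]
      exact CW.single (ag_ver hz1 hz2 hx)

lemma clamp_step {l : ℤ} {c : Vtx → Vtx → ℝ} {q : ℕ} {υ : ℕ → ℤ} (H : YHyp l c q υ)
    (Y Z X : Set ℤ) (φ : ℤ → ℤ) (hφ : ∀ y, φ (y + 1) = φ y ∨ (φ y = y ∧ φ (y + 1) = y + 1))
    (hD : ∀ y, Dom q υ y (φ y)) (hY : ∀ y ∉ Y, φ y ∉ Y ∪ Z)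
    {u v : Vtx} {C : ℝ} (h : CW (Ag l Y X) c u v C) :
    ∃ C' ≤ C, CW (Ag l (Y ∪ Z) X) c (mapY φ u) (mapY φ v) C' := by
  have key := round_step H (Finset.univ : Finset Unit) ⟨(), by simp⟩ (fun _ => φ) Y (Y ∪ Z) X
    (fun _ _ y => hD y) (fun _ _ => hY) ?_ h
  · obtain ⟨_, -, h⟩ := key
    exact h
  · intro x y z hz1 hz2 hx
    rcases hφ y with e | ⟨e1, e2⟩
    · refine ⟨fun _ => 0, fun _ _ => ?_, ?_⟩
      · rw [e]; exact CW.nil _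
      · simpa using H.nonneg _ _ (adj_ver hz1 hz2)
    · refine ⟨fun _ => c (x, y, z) (x, y + 1, z), fun _ _ => ?_, by simp⟩
      rw [e1, e2]
      exact CW.single (ag_ver hz1 hz2 hx)

/-- Levels above `s` with no grid line in between. -/
def UpS (q : ℕ) (υ : ℕ → ℤ) (s : ℤ) : Set ℤ :=
  {y | s < y ∧ ∀ j, 1 ≤ j → j ≤ q → ¬ (s < υ j ∧ υ j ≤ y)}

/-- Levels below `s` with no grid line in between. -/
def LoS (q : ℕ) (υ : ℕ → ℤ) (s : ℤ) : Set ℤ :=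
  {y | y < s ∧ ∀ j, 1 ≤ j → j ≤ q → ¬ (y ≤ υ j ∧ υ j < s)}

lemma exists_min_above (q : ℕ) (υ : ℕ → ℤ) (s : ℤ) (h : ∃ j, 1 ≤ j ∧ j ≤ q ∧ s < υ j) :
    ∃ k, 1 ≤ k ∧ k ≤ q ∧ s < υ k ∧ ∀ j, 1 ≤ j → j ≤ q → s < υ j → υ k ≤ υ j := by
  classical
  obtain ⟨j, h1, h2, h3⟩ := h
  obtain ⟨k, hk, hk'⟩ := Finset.exists_min_image
    ((Finset.Icc 1 q).filter (fun j => s < υ j)) υ ⟨j, by simp [h1, h2, h3]⟩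
  simp only [Finset.mem_filter, Finset.mem_Icc] at hk hk'
  exact ⟨k, hk.1.1, hk.1.2, hk.2, fun j a b d => hk' j ⟨⟨a, b⟩, d⟩⟩

lemma exists_max_below (q : ℕ) (υ : ℕ → ℤ) (s : ℤ) (h : ∃ j, 1 ≤ j ∧ j ≤ q ∧ υ j < s) :
    ∃ k, 1 ≤ k ∧ k ≤ q ∧ υ k < s ∧ ∀ j, 1 ≤ j → j ≤ q → υ j < s → υ j ≤ υ k := by
  classical
  obtain ⟨j, h1, h2, h3⟩ := h
  obtain ⟨k, hk, hk'⟩ := Finset.exists_max_image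
    ((Finset.Icc 1 q).filter (fun j => υ j < s)) υ ⟨j, by simp [h1, h2, h3]⟩
  simp only [Finset.mem_filter, Finset.mem_Icc] at hk hk'
  exact ⟨k, hk.1.1, hk.1.2, hk.2, fun j a b d => hk' j ⟨⟨a, b⟩, d⟩⟩

lemma up_step {l : ℤ} {c : Vtx → Vtx → ℝ} {q : ℕ} {υ : ℕ → ℤ} (H : YHyp l c q υ)
    (X : Set ℤ) (t : ℤ) {u v : Vtx} {C : ℝ} (h : CW (Ag l ∅ X) c u v C) :
    ∃ φ : ℤ → ℤ, φ t = t ∧ (∀ y, Dom q υ y (φ y)) ∧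
    ∃ C' ≤ C, CW (Ag l (UpS q υ t) X) c (mapY φ u) (mapY φ v) C' := by
  by_cases hex : ∃ j, 1 ≤ j ∧ j ≤ q ∧ t < υ j
  · obtain ⟨k, hk1, hk2, hk3, hk4⟩ := exists_min_above q υ t hex
    obtain ⟨φ, h1, h2, C', hC', hw⟩ := slab_step H ∅ X t (υ k) hk3 (by simp) (by simp)
      (fun j a b d => by have := hk4 j a b d.1; omega) h
    refine ⟨φ, h1 t (by simp), h2, C', hC', ?_⟩
    have : UpS q υ t = ∅ ∪ Set.Ioo t (υ k) := by
      ext y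
      simp only [UpS, Set.mem_ofPred_eq, Set.empty_union, Set.mem_Ioo]
      constructor
      · rintro ⟨a, b⟩
        have := b k hk1 hk2
        omega
      · rintro ⟨a, b⟩
        refine ⟨a, fun j c d e => ?_⟩
        have := hk4 j c d e.1
        omega
    rw [this]; exact hw
  · push Not at hex
    have : UpS q υ t = ∅ ∪ Set.Ioi t := by
      ext y
      simp only [UpS, Set.mem_ofPred_eq, Set.empty_union, Set.mem_Ioi]
      refine ⟨fun a => a.1, fun a => ⟨a, fun j c d e => ?_⟩⟩
      have := hex j c d
      omega
    have hD : ∀ y, Dom q υ y (min y t) := by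
      intro y j c d
      have := hex j c d
      omega
    refine ⟨fun y => min y t, by simp, hD, ?_⟩
    rw [this]
    refine clamp_step H ∅ _ X _ ?_ hD ?_ h
    · intro y; omega
    · intro y _; simp

lemma lo_step {l : ℤ} {c : Vtx → Vtx → ℝ} {q : ℕ} {υ : ℕ → ℤ} (H : YHyp l c q υ)
    (X : Set ℤ) (t : ℤ) (Y : Set ℤ) (hY : ∀ y ∈ Y, t < y)
    {u v : Vtx} {C : ℝ} (h : CW (Ag l Y X) c u v C) :
    ∃ φ : ℤ → ℤ, φ t = t ∧ (∀ y, Dom q υ y (φ y)) ∧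
    ∃ C' ≤ C, CW (Ag l (Y ∪ LoS q υ t) X) c (mapY φ u) (mapY φ v) C' := by
  have htY : t ∉ Y := fun h => lt_irrefl _ (hY t h)
  by_cases hex : ∃ j, 1 ≤ j ∧ j ≤ q ∧ υ j < t
  · obtain ⟨k, hk1, hk2, hk3, hk4⟩ := exists_max_below q υ t hex
    obtain ⟨φ, h1, h2, C', hC', hw⟩ := slab_step H Y X (υ k) t hk3
      (fun h => by have := hY _ h; omega) htY
      (fun j a b d => by have := hk4 j a b d.2; omega) h
    refine ⟨φ, h1 t (by simp), h2, C', hC', ?_⟩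
    have : LoS q υ t = Set.Ioo (υ k) t := by
      ext y
      simp only [LoS, Set.mem_ofPred_eq, Set.mem_Ioo]
      constructor
      · rintro ⟨a, b⟩
        have := b k hk1 hk2
        omega
      · rintro ⟨a, b⟩
        refine ⟨b, fun j c d e => ?_⟩
        have := hk4 j c d e.2
        omega
    rw [this]; exact hw
  · push Not at hex
    have : LoS q υ t = Set.Iio t := by
      ext y
      simp only [LoS, Set.mem_ofPred_eq, Set.mem_Iio]
      refine ⟨fun a => a.1, fun a => ⟨a, fun j c d e => ?_⟩⟩
      have := hex j c d
      omega
    have hD : ∀ y, Dom q υ y (max y t) := by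
      intro y j c d
      have := hex j c d
      omega
    refine ⟨fun y => max y t, by simp, hD, ?_⟩
    rw [this]
    refine clamp_step H Y _ X _ ?_ hD ?_ h
    · intro y; omega
    · intro y hy
      simp only [Set.mem_union, Set.mem_Iio, not_or]
      refine ⟨?_, by omega⟩
      rcases le_total y t with e | e
      · rwa [max_eq_right e]
      · rwa [max_eq_left e]

lemma y_step {l : ℤ} {c : Vtx → Vtx → ℝ} {q : ℕ} {υ : ℕ → ℤ} (H : YHyp l c q υ)
    (X : Set ℤ) (T : Set Vtx) (hT : ∀ x y z y', (x, y, z) ∈ T → Dom q υ y y' → (x, y', z) ∈ T)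
    {s v : Vtx} (hv : v ∈ T) {C : ℝ} (h : CW (Ag l ∅ X) c s v C) :
    ∃ v' ∈ T, ∃ C' ≤ C, CW (Ag l (UpS q υ s.2.1 ∪ LoS q υ s.2.1) X) c s v' C' := by
  obtain ⟨φ, h1, h2, C', hC', hw⟩ := up_step H X s.2.1 h
  obtain ⟨ψ, h3, h4, C'', hC'', hw'⟩ := lo_step H X s.2.1 _ (fun y hy => hy.1) hw
  refine ⟨mapY ψ (mapY φ v), ?_, C'', hC''.trans hC', ?_⟩
  · exact hT _ _ _ _ (hT v.1 v.2.1 v.2.2 _ hv (h2 _)) (h4 _)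
  · have : mapY ψ (mapY φ s) = s := by simp [mapY, h1, h3]
    rwa [this] at hw'

/-- The cost of an edge in the tile with indices `i, j`. -/
noncomputable def tileCost (ch cv cvia : ℕ → ℕ → ℤ → ℝ) (u v : Vtx) (i j : ℕ) : ℝ :=
  if u.1 ≠ v.1 then ch i j u.2.2
  else if u.2.1 ≠ v.2.1 then cv i j u.2.2
  else cvia i j (min u.2.2 v.2.2)

/-- The set of applicable costs of an edge. -/
def GS (p q : ℕ) (ξ υ : ℕ → ℤ) (ch cv cvia : ℕ → ℕ → ℤ → ℝ) (u v : Vtx) : Set ℝ :=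
  { m : ℝ | ∃ i j : ℕ, i ≤ p ∧ j ≤ q ∧
    inSeg p ξ i u.1 ∧ inSeg p ξ i v.1 ∧ inSeg q υ j u.2.1 ∧ inSeg q υ j v.2.1 ∧
    m = tileCost ch cv cvia u v i j }

lemma gecost_eq (p q : ℕ) (ξ υ : ℕ → ℤ) (ch cv cvia : ℕ → ℕ → ℤ → ℝ) (u v : Vtx) :
    gecost p q ξ υ ch cv cvia u v = sInf (GS p q ξ υ ch cv cvia u v) := rfl

lemma GS_finite (p q : ℕ) (ξ υ : ℕ → ℤ) (ch cv cvia : ℕ → ℕ → ℤ → ℝ) (u v : Vtx) :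
    (GS p q ξ υ ch cv cvia u v).Finite := by
  refine Set.Finite.subset (((Finset.range (p + 1)) ×ˢ (Finset.range (q + 1))).image
    (fun r => tileCost ch cv cvia u v r.1 r.2)).finite_toSet ?_
  rintro m ⟨i, j, h1, h2, -, -, -, -, h3⟩
  simp only [Finset.coe_image, Set.mem_image, Finset.mem_coe, Finset.mem_product,
    Finset.mem_range]
  exact ⟨(i, j), ⟨by omega, by omega⟩, h3.symm⟩

lemma seg_exists (n : ℕ) (ξ : ℕ → ℤ) (x : ℤ) :
    ∃ i ≤ n, (i = 0 ∨ ξ i ≤ x) ∧ (i = n ∨ x + 1 ≤ ξ (i + 1)) ∧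
      ∀ k, 1 ≤ k → k ≤ n → ξ k ≤ x → k ≤ i := by
  classical
  let Pr : ℕ → Prop := fun i => i = 0 ∨ ξ i ≤ x
  refine ⟨Nat.findGreatest Pr n, Nat.findGreatest_le n, ?_, ?_, ?_⟩
  · exact Nat.findGreatest_spec (P := Pr) (Nat.zero_le n) (Or.inl rfl)
  · by_contra hcon
    push Not at hcon
    have h1 : Nat.findGreatest Pr n + 1 ≤ n := by
      have := Nat.findGreatest_le (P := Pr) n
      omega
    have := Nat.findGreatest_is_greatest (P := Pr) (Nat.lt_succ_self _) h1
    apply this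
    right
    have := hcon.2
    simp only [Nat.succ_eq_add_one]
    omega
  · intro k _ h2 h3
    exact Nat.le_findGreatest h2 (Or.inr h3)

lemma seg_exists' (n : ℕ) (ξ : ℕ → ℤ) (x : ℤ) :
    ∃ i ≤ n, inSeg n ξ i x ∧
      ∀ k, 1 ≤ k → k ≤ n → x ≤ ξ k → i + 1 ≤ k := by
  classical
  have hex : ∃ i, i = n ∨ x ≤ ξ (i + 1) := ⟨n, Or.inl rfl⟩
  refine ⟨Nat.find hex, Nat.find_min' hex (Or.inl rfl), ⟨?_, Nat.find_spec hex⟩, ?_⟩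
  · rcases Nat.eq_zero_or_pos (Nat.find hex) with h | h
    · exact Or.inl h
    · right
      have := Nat.find_min hex (m := Nat.find hex - 1) (by omega)
      push Not at this
      have h2 := this.2
      rw [Nat.sub_add_cancel h] at h2
      omega
  · intro k h1 h2 h3
    have := Nat.find_min' hex (m := k - 1) (Or.inr (by rwa [Nat.sub_add_cancel h1]))
    omega

lemma seg_pair (n : ℕ) (ξ : ℕ → ℤ) (x x' : ℤ) (h : |x - x'| ≤ 1) :
    ∃ i ≤ n, inSeg n ξ i x ∧ inSeg n ξ i x' := by
  have h' := abs_le.1 h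
  obtain ⟨i, h1, h2, h3, -⟩ := seg_exists n ξ (min x x')
  refine ⟨i, h1, ⟨?_, ?_⟩, ⟨?_, ?_⟩⟩ <;> omega

lemma GS_nonempty {l : ℤ} (p q : ℕ) (ξ υ : ℕ → ℤ) (ch cv cvia : ℕ → ℕ → ℤ → ℝ) (u v : Vtx)
    (h : Adj l u v) : (GS p q ξ υ ch cv cvia u v).Nonempty := by
  obtain ⟨-, -, -, -, h5⟩ := h
  have e1 := abs_nonneg (u.1 - v.1)
  have e2 := abs_nonneg (u.2.1 - v.2.1)
  have e3 := abs_nonneg (u.2.2 - v.2.2)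
  obtain ⟨i, a1, a2, a3⟩ := seg_pair p ξ u.1 v.1 (by omega)
  obtain ⟨j, b1, b2, b3⟩ := seg_pair q υ u.2.1 v.2.1 (by omega)
  exact ⟨_, i, j, a1, b1, a2, a3, b2, b3, rfl⟩

lemma inSeg_dom {q : ℕ} {υ : ℕ → ℤ} {y y' : ℤ} (h : Dom q υ y y') {j : ℕ} (hj : j ≤ q)
    (hs : inSeg q υ j y) : inSeg q υ j y' := by
  obtain ⟨h1, h2⟩ := hs
  constructor
  · rcases Nat.eq_zero_or_pos j with e | e
    · exact Or.inl e
    · rcases h1 with h1 | h1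
      · exact Or.inl h1
      · exact Or.inr ((h j e hj).1 h1)
  · rcases h2 with h2 | h2
    · exact Or.inl h2
    · rcases Nat.lt_or_ge j q with e | e
      · exact Or.inr ((h (j + 1) (by omega) e).2 h2)
      · exact Or.inl (by omega)

lemma adj_cases {l : ℤ} {u v : Vtx} (h : Adj l u v) :
    (u.1 ≠ v.1 ∧ u.2.1 = v.2.1 ∧ u.2.2 = v.2.2) ∨ (u.1 = v.1 ∧ u.2.1 ≠ v.2.1 ∧ u.2.2 = v.2.2) ∨
    (u.1 = v.1 ∧ u.2.1 = v.2.1 ∧ u.2.2 ≠ v.2.2) := by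
  obtain ⟨-, -, -, -, h5⟩ := h
  rcases abs_cases (u.1 - v.1) with ⟨e1, _⟩ | ⟨e1, _⟩ <;>
  rcases abs_cases (u.2.1 - v.2.1) with ⟨e2, _⟩ | ⟨e2, _⟩ <;>
  rcases abs_cases (u.2.2 - v.2.2) with ⟨e3, _⟩ | ⟨e3, _⟩ <;> omega

lemma inSeg_flat {q : ℕ} {υ : ℕ → ℤ} {a b : ℤ}
    (hno : ∀ j, 1 ≤ j → j ≤ q → ¬ (a < υ j ∧ υ j < b)) {y y' : ℤ} (h1 : a ≤ y) (h2 : y < b)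
    (h3 : a ≤ y') (h4 : y' < b) {j : ℕ} (hj : j ≤ q) (hs : inSeg q υ j y)
    (hs' : inSeg q υ j (y + 1)) : inSeg q υ j y' ∧ inSeg q υ j (y' + 1) := by
  obtain ⟨a1, a2⟩ := hs
  obtain ⟨b1, b2⟩ := hs'
  have n1 : j = 0 ∨ ¬ (a < υ j ∧ υ j < b) := by
    rcases Nat.eq_zero_or_pos j with e | e
    · exact Or.inl e
    · exact Or.inr (hno j e hj)
  have n2 : j = q ∨ ¬ (a < υ (j + 1) ∧ υ (j + 1) < b) := by
    rcases Nat.lt_or_ge j q with e | e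
    · exact Or.inr (hno (j + 1) (by omega) e)
    · exact Or.inl (by omega)
  refine ⟨⟨?_, ?_⟩, ⟨?_, ?_⟩⟩ <;> omega

/-- Positivity of all tile costs. -/
structure PosC (l : ℤ) (p q : ℕ) (ch cv cvia : ℕ → ℕ → ℤ → ℝ) : Prop where
  hch : ∀ i j z, i ≤ p → j ≤ q → 1 ≤ z → z ≤ l → 0 < ch i j z
  hcv : ∀ i j z, i ≤ p → j ≤ q → 1 ≤ z → z ≤ l → 0 < cv i j z
  hcvia : ∀ i j z, i ≤ p → j ≤ q → 1 ≤ z → z < l → 0 < cvia i j z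

lemma gecost_mem_finite {l : ℤ} {p q : ℕ} (ξ υ : ℕ → ℤ) {ch cv cvia : ℕ → ℕ → ℤ → ℝ}
    (H : PosC l p q ch cv cvia) : ∃ K : Finset ℝ, (∀ m ∈ K, 0 < m) ∧
      ∀ u v, Adj l u v → gecost p q ξ υ ch cv cvia u v ∈ K := by
  classical
  let F1 := Finset.range (p + 1) ×ˢ Finset.range (q + 1) ×ˢ Finset.Icc 1 l
  let F2 := Finset.range (p + 1) ×ˢ Finset.range (q + 1) ×ˢ Finset.Ico 1 l
  refine ⟨F1.image (fun r => ch r.1 r.2.1 r.2.2) ∪ F1.image (fun r => cv r.1 r.2.1 r.2.2) ∪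
    F2.image (fun r => cvia r.1 r.2.1 r.2.2), ?_, ?_⟩
  · intro m hm
    simp only [F1, F2, Finset.mem_union, Finset.mem_image, Finset.mem_product, Finset.mem_range,
      Finset.mem_Icc, Finset.mem_Ico] at hm
    rcases hm with (⟨r, ⟨h1, h2, h3, h4⟩, rfl⟩ | ⟨r, ⟨h1, h2, h3, h4⟩, rfl⟩) |
      ⟨r, ⟨h1, h2, h3, h4⟩, rfl⟩
    · exact H.hch _ _ _ (by omega) (by omega) h3 h4
    · exact H.hcv _ _ _ (by omega) (by omega) h3 h4
    · exact H.hcvia _ _ _ (by omega) (by omega) h3 h4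
  · intro u v h
    have hm := (GS_nonempty p q ξ υ ch cv cvia u v h).csInf_mem (GS_finite p q ξ υ ch cv cvia u v)
    rw [gecost_eq]
    obtain ⟨i, j, h1, h2, -, -, -, -, h3⟩ := hm
    rw [h3]
    have hc := adj_cases h
    obtain ⟨z1, z2, z3, z4, -⟩ := h
    simp only [F1, F2, Finset.mem_union, Finset.mem_image, Finset.mem_product, Finset.mem_range,
      Finset.mem_Icc, Finset.mem_Ico]
    unfold tileCost
    split_ifs with e1 e2
    · exact Or.inl (Or.inl ⟨(i, j, u.2.2), ⟨by simp only; omega, by simp only; omega, z1, z2⟩, rfl⟩)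
    · exact Or.inl (Or.inr ⟨(i, j, u.2.2), ⟨by simp only; omega, by simp only; omega, z1, z2⟩, rfl⟩)
    · refine Or.inr ⟨(i, j, min u.2.2 v.2.2), ⟨by simp only; omega, by simp only; omega, ?_, ?_⟩, rfl⟩
      · simp only; omega
      · simp only; omega

lemma gecost_pos {l : ℤ} {p q : ℕ} (ξ υ : ℕ → ℤ) {ch cv cvia : ℕ → ℕ → ℤ → ℝ}
    (H : PosC l p q ch cv cvia) (u v : Vtx) (h : Adj l u v) :
    0 < gecost p q ξ υ ch cv cvia u v := by
  obtain ⟨K, h1, h2⟩ := gecost_mem_finite ξ υ H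
  exact h1 _ (h2 u v h)

lemma gecost_yhyp {l : ℤ} {p q : ℕ} (ξ υ : ℕ → ℤ) {ch cv cvia : ℕ → ℕ → ℤ → ℝ}
    (H : PosC l p q ch cv cvia) : YHyp l (gecost p q ξ υ ch cv cvia) q υ where
  nonneg u v h := (gecost_pos ξ υ H u v h).le
  symm u v h := by
    rw [gecost_eq, gecost_eq]
    have ht : ∀ i j, tileCost ch cv cvia u v i j = tileCost ch cv cvia v u i j := by
      intro i j
      unfold tileCost
      rcases adj_cases h with ⟨h1, h2, h3⟩ | ⟨h1, h2, h3⟩ | ⟨h1, h2, h3⟩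
      · simp [h1, h1.symm, h3]
      · simp [h1, h2, h2.symm, h3]
      · simp [h1, h2, min_comm]
    congr 1
    ext m
    constructor
    · rintro ⟨i, j, h1, h2, h3, h4, h5, h6, h7⟩
      exact ⟨i, j, h1, h2, h4, h3, h6, h5, by rw [← ht]; exact h7⟩
    · rintro ⟨i, j, h1, h2, h3, h4, h5, h6, h7⟩
      exact ⟨i, j, h1, h2, h4, h3, h6, h5, by rw [ht]; exact h7⟩
  mono y y' hD x x' z z' h := by
    rw [gecost_eq, gecost_eq]
    refine csInf_le_csInf (GS_finite _ _ _ _ _ _ _ _ _).bddBelow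
      (GS_nonempty p q ξ υ ch cv cvia _ _ h) ?_
    rintro m ⟨i, j, h1, h2, h3, h4, h5, h6, h7⟩
    refine ⟨i, j, h1, h2, h3, h4, inSeg_dom hD h2 h5, inSeg_dom hD h2 h6, ?_⟩
    rw [h7]
    simp [tileCost]
  flat a b hno y y' h1 h2 h3 h4 x z _ _ := by
    rw [gecost_eq, gecost_eq]
    congr 1
    ext m
    constructor
    · rintro ⟨i, j, a1, a2, a3, a4, a5, a6, a7⟩
      obtain ⟨b1, b2⟩ := inSeg_flat hno h1 h2 h3 h4 a2 a5 a6
      refine ⟨i, j, a1, a2, a3, a4, b1, b2, ?_⟩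
      rw [a7]; simp [tileCost]
    · rintro ⟨i, j, a1, a2, a3, a4, a5, a6, a7⟩
      obtain ⟨b1, b2⟩ := inSeg_flat hno h3 h4 h1 h2 a2 a5 a6
      refine ⟨i, j, a1, a2, a3, a4, b1, b2, ?_⟩
      rw [a7]; simp [tileCost]

/-- Swap the first two coordinates. -/
def swp (u : Vtx) : Vtx := (u.2.1, u.1, u.2.2)

lemma Adj.swp {l : ℤ} {u v : Vtx} (h : Adj l u v) : Adj l (swp u) (swp v) := by
  obtain ⟨h1, h2, h3, h4, h5⟩ := h
  refine ⟨h1, h2, h3, h4, ?_⟩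
  rw [← h5]
  simp only [_root_.swp]
  ring

lemma Ag.swp {l : ℤ} {Y X : Set ℤ} {u v : Vtx} (h : Ag l Y X u v) :
    Ag l X Y (swp u) (swp v) := ⟨h.1.swp, h.2.2, h.2.1⟩

lemma gecost_swp {l : ℤ} (p q : ℕ) (ξ υ : ℕ → ℤ) (ch cv cvia : ℕ → ℕ → ℤ → ℝ) (u v : Vtx)
    (h : Adj l u v) : gecost p q ξ υ ch cv cvia u v =
    gecost q p υ ξ (fun i j => cv j i) (fun i j => ch j i) (fun i j => cvia j i)
      (swp u) (swp v) := by
  have ht : ∀ i j, tileCost ch cv cvia u v i j = tileCost (fun i j => cv j i)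
      (fun i j => ch j i) (fun i j => cvia j i) (swp u) (swp v) j i := by
    intro i j
    unfold tileCost
    rcases adj_cases h with ⟨h1, h2, h3⟩ | ⟨h1, h2, h3⟩ | ⟨h1, h2, h3⟩ <;>
    simp [swp, h1, h2, h3]
  rw [gecost_eq, gecost_eq]
  congr 1
  ext m
  constructor
  · rintro ⟨i, j, h1, h2, h3, h4, h5, h6, h7⟩
    exact ⟨j, i, h2, h1, h5, h6, h3, h4, by rw [← ht]; exact h7⟩
  · rintro ⟨i, j, h1, h2, h3, h4, h5, h6, h7⟩
    exact ⟨j, i, h2, h1, h5, h6, h3, h4, by rw [ht]; exact h7⟩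

/-- Forbidden levels. -/
def Bad (q : ℕ) (υ : ℕ → ℤ) (t : ℤ) : Set ℤ := UpS q υ t ∪ LoS q υ t

lemma hanan {l : ℤ} {p q : ℕ} (ξ υ : ℕ → ℤ) {ch cv cvia : ℕ → ℕ → ℤ → ℝ}
    (H : PosC l p q ch cv cvia) (T : Set Vtx)
    (hTy : ∀ x y z y', (x, y, z) ∈ T → Dom q υ y y' → (x, y', z) ∈ T)
    (hTx : ∀ x y z x', (x, y, z) ∈ T → Dom p ξ x x' → (x', y, z) ∈ T)
    {s v : Vtx} (hv : v ∈ T) {C : ℝ} (h : CW (Adj l) (gecost p q ξ υ ch cv cvia) s v C) :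
    ∃ v' ∈ T, ∃ C' ≤ C, CW (Ag l (Bad q υ s.2.1) (Bad p ξ s.1))
      (gecost p q ξ υ ch cv cvia) s v' C' := by
  have h0 : CW (Ag l ∅ ∅) (gecost p q ξ υ ch cv cvia) s v C :=
    CW.map_rel id (fun u v h => ⟨h, by simp, by simp⟩) (fun _ _ _ => rfl) h
  obtain ⟨v1, hv1, C1, hC1, hw1⟩ := y_step (gecost_yhyp ξ υ H) ∅ T hTy hv h0
  have H' : PosC l q p (fun i j => cv j i) (fun i j => ch j i) (fun i j => cvia j i) :=
    ⟨fun i j z a b => H.hcv j i z b a, fun i j z a b => H.hch j i z b a,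
      fun i j z a b => H.hcvia j i z b a⟩
  have hw2 := CW.map_rel (A' := Ag l ∅ (Bad q υ s.2.1)) swp
    (c' := gecost q p υ ξ (fun i j => cv j i) (fun i j => ch j i) (fun i j => cvia j i))
    (fun u v h => Ag.swp h) (fun u v h => gecost_swp p q ξ υ ch cv cvia u v h.1) hw1
  obtain ⟨v2, hv2, C2, hC2, hw3⟩ := y_step (gecost_yhyp υ ξ H') (Bad q υ s.2.1)
    {u | swp u ∈ T} (fun x y z y' a b => hTx _ _ _ _ a b) (v := swp v1) hv1 hw2
  refine ⟨swp v2, hv2, C2, hC2.trans hC1, ?_⟩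
  refine CW.map_rel (A' := Ag l (Bad q υ s.2.1) (Bad p ξ s.1)) swp
    (fun u v h => Ag.swp h) (fun u v h => ?_) hw3
  exact (gecost_swp p q ξ υ ch cv cvia _ _ h.1.swp).symm

lemma consistent_closed {p q : ℕ} {ξ υ : ℕ → ℤ} {l : ℤ} {T : Set Vtx}
    (h : Consistent p q ξ υ l T) :
    (∀ x y z y', (x, y, z) ∈ T → Dom q υ y y' → (x, y', z) ∈ T) ∧
    (∀ x y z x', (x, y, z) ∈ T → Dom p ξ x x' → (x', y, z) ∈ T) ∧
    (∀ v ∈ T, 1 ≤ v.2.2 ∧ v.2.2 ≤ l) := by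
  obtain ⟨R, hR, rfl⟩ := h
  refine ⟨?_, ?_, ?_⟩
  · intro x y z y' hT hD
    simp only [Set.mem_iUnion] at hT ⊢
    obtain ⟨r, hr, h1, h2, h3, h4, h5⟩ := hT
    obtain ⟨a1, a2, a3, a4, a5, a6, a7, a8⟩ := hR r hr
    exact ⟨r, hr, h1, h2, (hD _ a4 (by omega)).1 h3, (hD _ (by omega) a6).2 h4, h5⟩
  · intro x y z x' hT hD
    simp only [Set.mem_iUnion] at hT ⊢
    obtain ⟨r, hr, h1, h2, h3, h4, h5⟩ := hT
    obtain ⟨a1, a2, a3, a4, a5, a6, a7, a8⟩ := hR r hr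
    exact ⟨r, hr, (hD _ a1 (by omega)).1 h1, (hD _ (by omega) a3).2 h2, h3, h4, h5⟩
  · intro v hv
    simp only [Set.mem_iUnion] at hv
    obtain ⟨r, hr, h1, h2, h3, h4, h5⟩ := hv
    obtain ⟨a1, a2, a3, a4, a5, a6, a7, a8⟩ := hR r hr
    rw [h5]
    exact ⟨a7, a8⟩

lemma line_connected {A : Vtx → Vtx → Prop} (hA : ∀ u v, A u v → A v u) (f : ℤ → Vtx) (a b : ℤ)
    (h : ∀ k, min a b ≤ k → k < max a b → A (f k) (f (k + 1))) :
    CW A (fun _ _ => 0) (f a) (f b) 0 := by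
  rcases le_total a b with hab | hab
  · have := CW.line (A := A) (c := fun _ _ => 0) f 0 a b hab
      (fun k h1 h2 => ⟨h k (by omega) (by omega), rfl⟩)
    simpa using this
  · have := CW.line (A := A) (c := fun _ _ => 0) f 0 b a hab
      (fun k h1 h2 => ⟨h k (by omega) (by omega), rfl⟩)
    simpa using this.reverse hA (fun _ _ _ => rfl)

lemma connected {l : ℤ} (c : Vtx → Vtx → ℝ) (u v : Vtx) (hu : 1 ≤ u.2.2 ∧ u.2.2 ≤ l)
    (hv : 1 ≤ v.2.2 ∧ v.2.2 ≤ l) : ∃ C, CW (Adj l) c u v C := by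
  obtain ⟨x, y, z⟩ := u
  obtain ⟨x', y', z'⟩ := v
  simp only at hu hv
  have hs : ∀ u v, Adj l u v → Adj l v u := fun _ _ => Adj.symm'
  have h1 := line_connected hs (fun k => (k, y, z)) x x'
    (fun k _ _ => ⟨hu.1, hu.2, hu.1, hu.2, by simp⟩)
  have h2 := line_connected hs (fun k => (x', k, z)) y y'
    (fun k _ _ => ⟨hu.1, hu.2, hu.1, hu.2, by simp⟩)
  have h3 := line_connected hs (fun k => (x', y', k)) z z'
    (fun k _ _ => ⟨by simp only; omega, by simp only; omega, by simp only; omega,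
      by simp only; omega, by simp⟩)
  exact ((h1.append h2).append h3).recost c

lemma exists_min_cost {A : Vtx → Vtx → Prop} {c : Vtx → Vtx → ℝ} (K : Finset ℝ)
    (hK : ∀ m ∈ K, 0 < m) (hc : ∀ u v, A u v → c u v ∈ K) (T : Set Vtx) (s : Vtx)
    (hne : ∃ v ∈ T, ∃ C, CW A c s v C) :
    ∃ v ∈ T, ∃ C, CW A c s v C ∧ ∀ w ∈ T, ∀ D, CW A c s w D → C ≤ D := by
  have hpwo : (AddSubmonoid.closure (K : Set ℝ) : Set ℝ).IsPWO :=
    Set.IsPWO.addSubmonoid_closure (fun x hx => (hK x hx).le) K.finite_toSet.isPWO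
  have hmem : ∀ {u v C}, CW A c u v C → C ∈ AddSubmonoid.closure (K : Set ℝ) := by
    intro u v C h
    induction h with
    | nil u => exact zero_mem _
    | cons a _ ih => exact add_mem (AddSubmonoid.subset_closure (hc _ _ a)) ih
  have hwf : {C | ∃ v ∈ T, CW A c s v C}.IsWF :=
    (hpwo.mono (by rintro C ⟨v, -, h⟩; exact hmem h)).isWF
  obtain ⟨v, hv, C, hC⟩ := hne
  have hne' : {C | ∃ v ∈ T, CW A c s v C}.Nonempty := ⟨C, v, hv, hC⟩
  obtain ⟨w, hw, hw'⟩ := hwf.min_mem hne'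
  exact ⟨w, hw, _, hw', fun x hx D hD => hwf.min_le hne' ⟨x, hx, hD⟩⟩

lemma wcost_drop_le {A : Vtx → Vtx → Prop} {c : Vtx → Vtx → ℝ} (hc : ∀ u v, A u v → 0 < c u v)
    (P : List Vtx) (hP : P.IsChain A) (t : ℕ) : wcost c (P.drop t) ≤ wcost c P := by
  induction P generalizing t with
  | nil => simp
  | cons x P ih =>
    cases t with
    | zero => simp
    | succ t =>
      rw [List.drop_succ_cons]
      cases P with
      | nil => simp [wcost]
      | cons y P =>
        have h := List.isChain_cons_cons.1 hP
        have h1 := ih h.2 t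
        have h2 := hc _ _ h.1
        simp only [wcost]
        linarith

lemma wcost_drop_lt {A : Vtx → Vtx → Prop} {c : Vtx → Vtx → ℝ} (hc : ∀ u v, A u v → 0 < c u v)
    (P : List Vtx) (hP : P.IsChain A) (t : ℕ) (ht : 1 ≤ t) (ht' : t < P.length) :
    wcost c (P.drop t) < wcost c P := by
  match P, t, ht with
  | [], _, _ => simp at ht'
  | [x], t + 1, _ => simp at ht'
  | x :: y :: P, t + 1, _ =>
    have h := List.isChain_cons_cons.1 hP
    have h1 := wcost_drop_le hc (y :: P) h.2 t
    have h2 := hc _ _ h.1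
    rw [List.drop_succ_cons]
    simp only [wcost]
    linarith

lemma mono_of_step {n : ℕ} {ξ : ℕ → ℤ} (hξ : ∀ i, 1 ≤ i → i < n → ξ i ≤ ξ (i + 1))
    (i j : ℕ) (hi : 1 ≤ i) (hij : i ≤ j) (hj : j ≤ n) : ξ i ≤ ξ j := by
  induction j, hij using Nat.le_induction with
  | base => exact le_rfl
  | succ k hk ih => exact (ih (by omega)).trans (hξ k (by omega) (by omega))

lemma mem_bad {n : ℕ} {ξ : ℕ → ℤ} (hξ : ∀ i, 1 ≤ i → i < n → ξ i ≤ ξ (i + 1)) (t x : ℤ)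
    (hne : x ≠ t) (h : ∀ i ≤ n, inSeg n ξ i x → inSeg n ξ i t) : x ∈ Bad n ξ t := by
  rcases lt_or_gt_of_ne hne with hlt | hgt
  · right
    refine ⟨hlt, fun j h1 h2 h3 => ?_⟩
    obtain ⟨i, hi, hs, hi'⟩ := seg_exists' n ξ x
    have h4 := hi' j h1 h2 h3.1
    have h5 := mono_of_step hξ (i + 1) j (by omega) h4 h2
    have h6 := (h i hi hs).2
    omega
  · left
    refine ⟨hgt, fun j h1 h2 h3 => ?_⟩
    obtain ⟨i, hi, hs1, hs2, hi'⟩ := seg_exists n ξ x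
    have h4 := hi' j h1 h2 h3.2
    have h5 := mono_of_step hξ j i h1 h4 hi
    have h6 := (h i hi ⟨hs1, by omega⟩).1
    omega

lemma onlyTiles_bad {p q : ℕ} {ξ υ : ℕ → ℤ}
    (hξ : ∀ i, 1 ≤ i → i < p → ξ i ≤ ξ (i + 1)) (hυ : ∀ j, 1 ≤ j → j < q → υ j ≤ υ (j + 1))
    {s v : Vtx} (h : OnlyTilesOf p q ξ υ s v) :
    v.2.2 = s.2.2 ∧ (v.1 ≠ s.1 → v.1 ∈ Bad p ξ s.1) ∧ (v.2.1 ≠ s.2.1 → v.2.1 ∈ Bad q υ s.2.1) := by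
  obtain ⟨i, hi, hi', -⟩ := seg_exists' p ξ v.1
  obtain ⟨j, hj, hj', -⟩ := seg_exists' q υ v.2.1
  refine ⟨(h i j hi hj hi' hj').2.2.symm, fun hne => ?_, fun hne => ?_⟩
  · exact mem_bad hξ _ _ hne (fun i hi hs => (h i j hi hj hs hj').1)
  · exact mem_bad hυ _ _ hne (fun j hj hs => (h i j hi hj hi' hs).2.1)

/-- In the general cost model, for a target set `T` consistent with the grid
and `s ∉ T`, there is a minimum-cost path `P` from `s` to `T` such that all edges of `P`
preceding the first vertex of `P` lying in a tile in which `s` does not lie are of the same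
type (horizontal, vertical or via). -/
theorem stmt8 (l : ℤ) (hl : 1 ≤ l) (p q : ℕ) (ξ υ : ℕ → ℤ)
    (hξ : ∀ i, 1 ≤ i → i < p → ξ i ≤ ξ (i + 1)) (hυ : ∀ j, 1 ≤ j → j < q → υ j ≤ υ (j + 1))
    (ch cv cvia : ℕ → ℕ → ℤ → ℝ)
    (hch : ∀ i j z, i ≤ p → j ≤ q → 1 ≤ z → z ≤ l → 0 < ch i j z)
    (hcv : ∀ i j z, i ≤ p → j ≤ q → 1 ≤ z → z ≤ l → 0 < cv i j z)
    (hcvia : ∀ i j z, i ≤ p → j ≤ q → 1 ≤ z → z < l → 0 < cvia i j z)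
    (T : Set Vtx) (hTne : T.Nonempty) (hTcon : Consistent p q ξ υ l T)
    (s : Vtx) (hs : 1 ≤ s.2.2 ∧ s.2.2 ≤ l) (hsT : s ∉ T) :
    ∃ (P : List Vtx) (v : Vtx), v ∈ T ∧ IsWalkA (Adj l) P s v ∧
      (∀ (Q : List Vtx) (w : Vtx), w ∈ T → IsWalkA (Adj l) Q s w →
        wcost (gecost p q ξ υ ch cv cvia) P ≤ wcost (gecost p q ξ υ ch cv cvia) Q) ∧
      ∃ d : Dir, ∀ t : ℕ, (ht : t + 1 < P.length) →
        (∀ u : ℕ, (hu : u ≤ t) → OnlyTilesOf p q ξ υ s (P[u]'(by omega))) →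
        dirOf (P[t]'(by omega)) (P[t + 1]'ht) = d := by
  classical
  have H : PosC l p q ch cv cvia := ⟨hch, hcv, hcvia⟩
  obtain ⟨hTy, hTx, hTz⟩ := consistent_closed hTcon
  obtain ⟨K, hK, hKc⟩ := gecost_mem_finite ξ υ H
  set c := gecost p q ξ υ ch cv cvia with hcdef
  set A := Ag l (Bad q υ s.2.1) (Bad p ξ s.1) with hA
  obtain ⟨w0, hw0⟩ := hTne
  obtain ⟨C0, hC0⟩ := connected (l := l) c s w0 hs (hTz w0 hw0)
  obtain ⟨w1, hw1, C1, -, hC1⟩ := hanan ξ υ H T hTy hTx hw0 hC0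
  obtain ⟨v, hv, C, hC, hmin⟩ := exists_min_cost K hK (fun u v h => hKc u v h.1) T s
    ⟨w1, hw1, C1, hC1⟩
  obtain ⟨P, hP, hPC⟩ := hC.toList
  obtain ⟨hP1, hP2, hP3, hP4⟩ := hP
  have hpos : ∀ u v, A u v → 0 < c u v := fun u v h => hK _ (hKc u v h.1)
  refine ⟨P, v, hv, ⟨hP1, List.IsChain.imp (fun _ _ h => h.1) hP2, hP3, hP4⟩, ?_, ?_⟩
  · intro Q w hw hQ
    have hQ' := CW.ofList (c := c) Q hQ
    obtain ⟨w', hw', D, hD, hDw⟩ := hanan ξ υ H T hTy hTx hw hQ'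
    rw [hPC]
    exact (hmin w' hw' D hDw).trans hD
  · have hlen0 : 0 < P.length := List.length_pos_of_ne_nil hP1
    have hhead : P[0] = s := by
      rw [List.head?_eq_getElem?, List.getElem?_eq_getElem hlen0] at hP3
      exact Option.some.inj hP3
    -- the walk does not return to its start
    have hsimple : ∀ t (ht : t < P.length), 1 ≤ t → P[t] ≠ s := by
      intro t ht h1 he
      have hd : IsWalkA A (P.drop t) s v := by
        refine ⟨?_, hP2.drop t, ?_, ?_⟩
        · simpa using ht
        · rw [List.head?_drop, List.getElem?_eq_getElem ht, he]
        · rw [List.getLast?_drop, if_neg (by omega)]; exact hP4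
      have h2 := hmin v hv _ (CW.ofList (c := c) _ hd)
      have h3 := wcost_drop_lt hpos P hP2 t h1 ht
      linarith
    have hedge : ∀ t (ht : t + 1 < P.length), A P[t] P[t + 1] := by
      intro t ht
      exact List.isChain_iff_getElem.1 hP2 t ht
    by_cases hlen : 1 < P.length
    · have he0 := hedge 0 hlen
      rcases adj_cases he0.1 with ⟨h1, h2, h3⟩ | ⟨h1, h2, h3⟩ | ⟨h1, h2, h3⟩
      · refine ⟨.hor, ?_⟩
        have key : ∀ t : ℕ, (ht : t + 1 < P.length) →
            (∀ u : ℕ, (hu : u ≤ t) → OnlyTilesOf p q ξ υ s (P[u]'(by omega))) →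
            P[t].1 ≠ P[t + 1].1 ∧ P[t + 1].2.1 = s.2.1 := by
          intro t
          induction t with
          | zero => intro ht _; exact ⟨h1, by rw [← h2, hhead]⟩
          | succ t ih =>
            intro ht hO
            obtain ⟨-, i2⟩ := ih (by omega) (fun u hu => hO u (by omega))
            obtain ⟨o1, o2, -⟩ := onlyTiles_bad hξ hυ (hO (t + 1) le_rfl)
            have hne : P[t + 1].1 ≠ s.1 := fun e =>
              hsimple (t + 1) (by omega) (by omega) (Prod.ext e (Prod.ext i2 o1))
            have he := hedge (t + 1) ht
            have hx : P[t + 1].1 ≠ P[t + 1 + 1].1 := fun e => he.2.2 e (o2 hne)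
            refine ⟨hx, ?_⟩
            rcases adj_cases he.1 with g | g | g
            · rw [← g.2.1, i2]
            · exact absurd g.1 hx
            · exact absurd g.1 hx
        intro t ht hO
        have := (key t ht hO).1
        simp [dirOf, this]
      · refine ⟨.ver, ?_⟩
        have key : ∀ t : ℕ, (ht : t + 1 < P.length) →
            (∀ u : ℕ, (hu : u ≤ t) → OnlyTilesOf p q ξ υ s (P[u]'(by omega))) →
            P[t].1 = P[t + 1].1 ∧ P[t].2.1 ≠ P[t + 1].2.1 ∧ P[t + 1].1 = s.1 := by
          intro t
          induction t with
          | zero => intro ht _; exact ⟨h1, h2, by rw [← h1, hhead]⟩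
          | succ t ih =>
            intro ht hO
            obtain ⟨-, -, i2⟩ := ih (by omega) (fun u hu => hO u (by omega))
            obtain ⟨o1, -, o2⟩ := onlyTiles_bad hξ hυ (hO (t + 1) le_rfl)
            have hne : P[t + 1].2.1 ≠ s.2.1 := fun e =>
              hsimple (t + 1) (by omega) (by omega) (Prod.ext i2 (Prod.ext e o1))
            have he := hedge (t + 1) ht
            have hx : P[t + 1].2.1 ≠ P[t + 1 + 1].2.1 := fun e => he.2.1 e (o2 hne)
            rcases adj_cases he.1 with g | g | g
            · exact absurd g.2.1 hx
            · exact ⟨g.1, hx, by rw [← g.1, i2]⟩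
            · exact absurd g.2.1 hx
        intro t ht hO
        have := key t ht hO
        simp [dirOf, this.1, this.2.1]
      · refine ⟨.via, ?_⟩
        intro t ht hO
        cases t with
        | zero => 
          simp only [dirOf]
          rw [if_neg (not_not.2 h1), if_neg (not_not.2 h2)]
        | succ t =>
          exfalso
          obtain ⟨o1, -, -⟩ := onlyTiles_bad hξ hυ (hO 1 (by omega))
          apply h3
          rw [hhead]
          exact o1.symm
    · exact ⟨.hor, fun t ht => absurd ht (by omega)⟩
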